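/- For all integers k ≥ 1, m ≥ 1, and n ≥ 2m + 2k - 1, p^{2k}_{2,1}(m,n) = p^{2k}_{2,1}(m-1, n - 2m - 2k + 1) + p^{2k}_{2,2}(m, n - 2m), where p^{2k}_{2,i}(m,n) counts partitions of n with exactly m parts, all parts at least 2k, at most i-1 parts equal to 2k, every odd part plus 1 at least 2(m+k), and even parts (in decreasing order) satisfying λ_{i_ℓ} - λ_{i_{ℓ+2}} ≥ 4. -/

import Mathlib

/-!
Formalization of statements from "Even-Odd partition identities of
Rogers-Ramanujan type" (P. Afsharijoo).

A partition of `n` is modelled by Mathlib's `Nat.Partition n` (a multiset of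
positive parts summing to `n`).  Sorted-in-increasing-order lists of parts are
used to express the conditions on consecutive parts of the decreasing
enumeration `λ_1 ≥ λ_2 ≥ …`.
-/

/-- The parts of a partition, sorted in increasing order. -/
def Nat.Partition.sortedParts {n : ℕ} (p : n.Partition) : List ℕ :=
  p.parts.sort (· ≤ ·)

/-- The odd parts of a partition, sorted in increasing order. -/
def Nat.Partition.oddParts {n : ℕ} (p : n.Partition) : List ℕ :=
  (p.parts.filter (fun x => ¬ Even x)).sort (· ≤ ·)

/-- The even parts of a partition, sorted in increasing order. -/
def Nat.Partition.evenParts {n : ℕ} (p : n.Partition) : List ℕ :=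
  (p.parts.filter (fun x => Even x)).sort (· ≤ ·)

/-- `GapCond L d g` : any two entries of `L` lying `d` positions apart differ by at
least `g`.  When `L` lists parts in increasing order, this says that the
corresponding decreasing enumeration `λ_1 ≥ λ_2 ≥ …` satisfies
`λ_ℓ - λ_{ℓ+d} ≥ g` for every valid index `ℓ`.
In particular `GapCond p.sortedParts 1 2` says that any two parts of `p`
differ by at least `2` (no equal and no consecutive parts), and
`GapCond p.oddParts 2 4` says that the odd parts satisfy
`λ_{j_ℓ} - λ_{j_{ℓ+2}} ≥ 4`. -/
def GapCond (L : List ℕ) (d g : ℕ) : Prop :=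
  ∀ ℓ : ℕ, ℓ + d < L.length → g ≤ L[ℓ + d]! - L[ℓ]!

/-- `p2k k i m n` = number of partitions of `n` with exactly `m` parts, all parts
at least `2k`, at most `i - 1` parts equal to `2k`, every odd part plus `1` at
least `2(m+k)`, and even parts (in decreasing order) satisfying
`λ_{i_ℓ} - λ_{i_{ℓ+2}} ≥ 4`. -/
noncomputable def p2k (k i m n : ℕ) : ℕ :=
  Nat.card {p : n.Partition //
    Multiset.card p.parts = m ∧
    (∀ x ∈ p.parts, 2 * k ≤ x) ∧
    Multiset.count (2 * k) p.parts ≤ i - 1 ∧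
    (∀ x ∈ p.parts, ¬ Even x → 2 * (m + k) ≤ x + 1) ∧
    GapCond p.evenParts 2 4}

/-- A sorted list of even numbers satisfies `GapCond L 2 4` iff no two consecutive even
values have total multiplicity larger than `2`. -/
theorem gapCond_two_four_iff {L : List ℕ} (hs : L.Pairwise (· ≤ ·)) (he : ∀ x ∈ L, Even x) :
    GapCond L 2 4 ↔ ∀ x, L.count x + L.count (x + 2) ≤ 2 := by
  induction L with
  | nil => simp [GapCond]
  | cons a L ih =>
    rw [List.pairwise_cons] at hs
    have ih := ih hs.2 fun x hx => he x (List.mem_cons_of_mem _ hx)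
    match L, hs, he, ih with
    | [], _, _, _ => simp [GapCond, List.count_cons]; grind
    | [b], _, _, _ => simp [GapCond, List.count_cons]; grind
    | b :: c :: t, hs, he, ih =>
      have hsplit : GapCond (a :: b :: c :: t) 2 4 ↔ 4 ≤ c - a ∧ GapCond (b :: c :: t) 2 4 := by
        refine ⟨fun h => ⟨by simpa using h 0 (by simp), fun l hl => ?_⟩, fun h l hl => ?_⟩
        · have := h (l + 1) (by simp at hl ⊢; omega)
          simpa [show l + 1 + 2 = l + 2 + 1 by omega] using this
        · cases l with
          | zero => simpa using h.1
          | succ l =>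
            have := h.2 l (by simp at hl ⊢; omega)
            simpa [show l + 1 + 2 = l + 2 + 1 by omega] using this
      rw [hsplit, ih]
      obtain ⟨hab, hbc⟩ := hs
      rw [List.pairwise_cons, List.pairwise_cons] at hbc
      have hea := he a (by simp)
      have heb := he b (by simp)
      have hec := he c (by simp)
      rw [Nat.even_iff] at hea heb hec
      have h1 := hab b (by simp)
      have h2 := hbc.1 c (by simp)
      constructor
      · rintro ⟨hac, h⟩ x
        have hzero : ∀ y, y < c → t.count y = 0 := fun y hy =>
          List.count_eq_zero.2 fun hm => absurd (hbc.2.1 y hm) (by omega)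
        have hx := h x
        by_cases hxa : x = a ∨ x + 2 = a
        · have := hzero x (by omega)
          have := hzero (x + 2) (by omega)
          simp only [List.count_cons, beq_iff_eq]
          split_ifs <;> omega
        · rw [List.count_cons_of_ne (Ne.symm (by omega) : a ≠ x),
            List.count_cons_of_ne (Ne.symm (by omega) : a ≠ x + 2)]
          exact hx
      · intro h
        refine ⟨?_, fun x => ?_⟩
        · have hx := h a
          simp only [List.count_cons, beq_iff_eq] at hx
          split_ifs at hx <;> omega
        · have hx := h x
          rw [List.count_cons (b := a), List.count_cons (b := a)] at hx
          omega

/-- Multisets with sum `n`, cardinality `m`, all elements at least `c`, at most `j` elements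
equal to `c`, odd elements at least `M`, and at most two elements among any two consecutive
even values. The integer parameters make the shift identities below unconditional. -/
def evenOddMultisets (c j : ℕ) (M m n : ℤ) : Set (Multiset ℕ) :=
  {s | (s.sum : ℤ) = n ∧ (s.card : ℤ) = m ∧ (∀ x ∈ s, c ≤ x) ∧ s.count c ≤ j ∧
    (∀ x ∈ s, ¬ Even x → M ≤ x) ∧ ∀ x, Even x → s.count x + s.count (x + 2) ≤ 2}

theorem Nat.Partition.gapCond_evenParts_iff {n : ℕ} (p : n.Partition) :
    GapCond p.evenParts 2 4 ↔
      ∀ x, Even x → p.parts.count x + p.parts.count (x + 2) ≤ 2 := by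
  have hcount : ∀ x, p.evenParts.count x = (p.parts.filter (fun x => Even x)).count x := by
    intro x
    rw [Nat.Partition.evenParts, ← Multiset.coe_count, Multiset.sort_eq]
  rw [gapCond_two_four_iff (L := p.evenParts) (Multiset.pairwise_sort _ _)
    (fun x hx => by
      rw [Nat.Partition.evenParts, Multiset.mem_sort, Multiset.mem_filter] at hx
      exact hx.2)]
  simp only [hcount, Multiset.count_filter]
  refine forall_congr' fun x => ?_
  have : Even (x + 2) ↔ Even x := by grind
  by_cases hx : Even x <;> simp [this, hx]

theorem coe_p2k_eq_encard {k : ℕ} (hk : 1 ≤ k) (i m n : ℕ) :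
    (p2k k i m n : ℕ∞) =
      (evenOddMultisets (2 * k) (i - 1) (2 * (m + k) - 1) m n).encard := by
  have himage : evenOddMultisets (2 * k) (i - 1) (2 * (m + k) - 1) m n =
      Nat.Partition.parts '' {p : n.Partition |
        Multiset.card p.parts = m ∧ (∀ x ∈ p.parts, 2 * k ≤ x) ∧
        Multiset.count (2 * k) p.parts ≤ i - 1 ∧
        (∀ x ∈ p.parts, ¬ Even x → 2 * (m + k) ≤ x + 1) ∧ GapCond p.evenParts 2 4} := by
    ext s
    simp only [evenOddMultisets, Set.mem_ofPred_eq, Set.mem_image,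
      Nat.Partition.gapCond_evenParts_iff]
    constructor
    · rintro ⟨hsum, hcard, hmin, hcount, hodd, hgap⟩
      refine ⟨⟨s, fun {x} hx => ?_, by exact_mod_cast hsum⟩, ⟨by exact_mod_cast hcard, hmin,
        hcount, fun x hx he => ?_, hgap⟩, rfl⟩
      · have := hmin x hx
        omega
      · have := hodd x hx he
        omega
    · rintro ⟨p, ⟨hcard, hmin, hcount, hodd, hgap⟩, rfl⟩
      refine ⟨by exact_mod_cast p.parts_sum, by exact_mod_cast hcard, hmin, hcount,
        fun x hx he => ?_, hgap⟩
      have := hodd x hx he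
      omega
  rw [himage, Function.Injective.encard_image fun _ _ => Nat.Partition.ext,
    ← (Set.toFinite _).cast_ncard_eq, ← Nat.card_coe_set_eq]
  rfl

theorem encard_evenOddMultisets_shift (c j d : ℕ) (M m n : ℤ) :
    (evenOddMultisets (c + 2 * d) j (M + 2 * d) m n).encard =
      (evenOddMultisets c j M m (n - 2 * d * m)).encard := by
  have hinj : Function.Injective (fun x : ℕ => x + 2 * d) := add_left_injective _
  rw [← (Multiset.map_injective hinj).encard_image (evenOddMultisets c j M m _)]
  congr 1
  have hsum : ∀ t : Multiset ℕ, ((t.map (· + 2 * d)).sum : ℤ) = t.sum + 2 * d * t.card := by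
    intro t
    simp [Multiset.sum_map_add]
    ring
  have hcount : ∀ (t : Multiset ℕ) x, (t.map (· + 2 * d)).count (x + 2 * d) = t.count x :=
    fun t x => Multiset.count_map_eq_count' _ t hinj x
  have hcount_lt : ∀ (t : Multiset ℕ) x, x < 2 * d → (t.map (· + 2 * d)).count x = 0 := by
    intro t x hx
    rw [Multiset.count_eq_zero, Multiset.mem_map]
    rintro ⟨y, -, rfl⟩
    omega
  have hmem : ∀ t : Multiset ℕ,
      t.map (· + 2 * d) ∈ evenOddMultisets (c + 2 * d) j (M + 2 * d) m n ↔
      t ∈ evenOddMultisets c j M m (n - 2 * d * m) := by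
    intro t
    simp only [evenOddMultisets, Set.mem_ofPred_eq, hsum, hcount, Multiset.card_map,
      Multiset.forall_mem_map_iff]
    constructor
    · rintro ⟨h1, h2, h3, h4, h5, h6⟩
      refine ⟨by rw [← h1, ← h2]; ring, h2, fun x hx => by have := h3 x hx; omega, h4,
        fun x hx he => ?_, fun x he => ?_⟩
      · have := h5 x hx (by simpa [Nat.even_add] using he)
        push_cast at this
        omega
      · have := h6 (x + 2 * d) (by simpa [Nat.even_add] using he)
        rwa [add_right_comm, hcount, hcount] at this
    · rintro ⟨h1, h2, h3, h4, h5, h6⟩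
      refine ⟨by rw [h1, h2]; ring, h2, fun x hx => by have := h3 x hx; omega, h4,
        fun x hx he => ?_, fun x he => ?_⟩
      · have := h5 x hx (by simpa [Nat.even_add] using he)
        push_cast
        omega
      · rw [Nat.even_iff] at he
        by_cases hx : 2 * d ≤ x
        · obtain ⟨y, rfl⟩ := Nat.exists_eq_add_of_le' hx
          rw [add_right_comm, hcount, hcount]
          exact h6 y (by rw [Nat.even_iff]; omega)
        · rw [hcount_lt t x (by omega)]
          by_cases hx' : x + 2 < 2 * d
          · rw [hcount_lt t _ hx']
            omega
          · rw [show x + 2 = 0 + 2 * d by omega, hcount]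
            have := h6 0 (by simp)
            omega
  ext s
  refine ⟨fun hs => ?_, ?_⟩
  · have hback : (s.map (· - 2 * d)).map (· + 2 * d) = s := by
      rw [Multiset.map_map]
      refine (Multiset.map_congr rfl fun x hx => ?_).trans (Multiset.map_id s)
      have := hs.2.2.1 x hx
      simp only [Function.comp_apply, id_eq]
      omega
    exact ⟨_, (hmem _).1 (by rwa [hback]), hback⟩
  · rintro ⟨t, ht, rfl⟩
    exact (hmem t).2 ht

theorem encard_evenOddMultisets_not_mem {k : ℕ} {m : ℤ} (hm : 1 ≤ m) (n : ℤ) :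
    {s ∈ evenOddMultisets (2 * k) 0 (2 * (m + k) - 1) m n |
        s.count (2 * k + 2) ≤ 1 ∧ (2 * (m + k) - 1).toNat ∉ s}.encard =
      (evenOddMultisets (2 * k) 1 (2 * (m + k) - 1) m (n - 2 * m)).encard := by
  have hshift := encard_evenOddMultisets_shift (2 * k) 1 1 (2 * (m + k) - 1) m n
  norm_num at hshift
  rw [← hshift]
  congr 1
  ext s
  simp only [evenOddMultisets, Set.mem_ofPred_eq]
  constructor
  · rintro ⟨⟨h1, h2, h3, h4, h5, h6⟩, h7, h8⟩
    have h4 : 2 * k ∉ s := by simpa using h4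
    have hodd : ∀ x ∈ s, ¬ Even x → 2 * (m + k) - 1 + 2 ≤ x := by
      intro x hx he
      have := h5 x hx he
      have : x ≠ (2 * (m + k) - 1).toNat := fun h => h8 (h ▸ hx)
      rw [Nat.even_iff] at he
      omega
    refine ⟨h1, h2, fun x hx => ?_, h7, by simpa using hodd, h6⟩
    have := h3 x hx
    have : x ≠ 2 * k := fun h => h4 (h ▸ hx)
    by_cases he : Even x
    · rw [Nat.even_iff] at he
      omega
    · have := hodd x hx he
      omega
  · rintro ⟨h1, h2, h3, h4, h5, h6⟩
    refine ⟨⟨h1, h2, fun x hx => by have := h3 x hx; omega, ?_,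
      fun x hx he => by have := h5 x hx he; omega, h6⟩, h4, fun hx => ?_⟩
    · rw [Nat.le_zero, Multiset.count_eq_zero]
      intro hx
      have := h3 _ hx
      omega
    · have := h5 _ hx (by rw [Nat.even_iff]; omega)
      omega

theorem encard_evenOddMultisets_mem {k : ℕ} {m : ℤ} (hm : 1 ≤ m) (n : ℤ) :
    {s ∈ evenOddMultisets (2 * k) 0 (2 * (m + k) - 1) m n |
        s.count (2 * k + 2) ≤ 1 ∧ (2 * (m + k) - 1).toNat ∈ s}.encard =
      (evenOddMultisets (2 * k) 1 (2 * (m - 1 + k) - 1) (m - 1)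
        (n - (2 * (m + k) - 1) - 2 * (m - 1))).encard := by
  obtain ⟨M, hM⟩ : ∃ M : ℕ, (M : ℤ) = 2 * (m + k) - 1 := ⟨(2 * (m + k) - 1).toNat, by omega⟩
  have hshift := encard_evenOddMultisets_shift (2 * k) 1 1 (2 * (m - 1 + k) - 1) (m - 1) (n - M)
  rw [Nat.cast_one, mul_one, mul_one, show 2 * (m - 1 + k) - 1 + 2 = (M : ℤ) by omega] at hshift
  have hinj : Function.Injective fun t : Multiset ℕ => M ::ₘ t :=
    fun _ _ => (Multiset.cons_inj_right M).1
  rw [← hM, ← hshift, Int.toNat_natCast,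
    ← hinj.encard_image (evenOddMultisets _ 1 _ _ _)]
  congr 1
  ext s
  have hcount : ∀ (t : Multiset ℕ) x, Even x → (M ::ₘ t).count x = t.count x := by
    intro t x hx
    rw [Nat.even_iff] at hx
    exact Multiset.count_cons_of_ne (by omega) t
  simp only [evenOddMultisets, Set.mem_ofPred_eq, Set.mem_image]
  constructor
  · rintro ⟨⟨h1, h2, h3, h4, h5, h6⟩, h7, h8⟩
    obtain ⟨t, rfl⟩ := Multiset.exists_cons_of_mem h8
    rw [Multiset.sum_cons] at h1
    rw [Multiset.card_cons] at h2
    have h4 : 2 * k ∉ M ::ₘ t := by simpa using h4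
    refine ⟨t, ⟨by omega, by omega, fun x hx => ?_, by rwa [hcount _ _ (by grind)] at h7,
      fun x hx => h5 x (Multiset.mem_cons_of_mem hx), fun x hx => ?_⟩, rfl⟩
    · have hpos := Multiset.card_pos_iff_exists_mem.2 ⟨x, hx⟩
      have hx := Multiset.mem_cons_of_mem (b := M) hx
      have := h3 x hx
      have : x ≠ 2 * k := fun h => h4 (h ▸ hx)
      by_cases he : Even x
      · rw [Nat.even_iff] at he
        omega
      · have := h5 x hx he
        omega
    · rw [← hcount t x hx, ← hcount t (x + 2) (by grind)]
      exact h6 x hx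
  · rintro ⟨t, ⟨h1, h2, h3, h4, h5, h6⟩, rfl⟩
    refine ⟨⟨?_, ?_, ?_, ?_, ?_, fun x hx => ?_⟩, ?_, Multiset.mem_cons_self M t⟩
    · rw [Multiset.sum_cons]
      omega
    · rw [Multiset.card_cons]
      omega
    · intro x hx
      rcases Multiset.mem_cons.1 hx with rfl | hx
      · omega
      · have := h3 x hx
        omega
    · rw [hcount _ _ (by grind), Nat.le_zero, Multiset.count_eq_zero]
      intro hx
      have := h3 _ hx
      omega
    · intro x hx he
      rcases Multiset.mem_cons.1 hx with rfl | hx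
      · omega
      · exact h5 x hx he
    · rw [hcount t x hx, hcount t (x + 2) (by grind)]
      exact h6 x hx
    · rwa [hcount _ _ (by grind)]

theorem encard_evenOddMultisets_two_le_count {k : ℕ} {m : ℤ} (n : ℤ) :
    {s ∈ evenOddMultisets (2 * k) 0 (2 * (m + k) - 1) m n | ¬ s.count (2 * k + 2) ≤ 1}.encard =
      (evenOddMultisets (2 * k) 0 (2 * (m - 1 - 1 + k) - 1) (m - 1 - 1)
        (n - (2 * (m + k) - 1) - (2 * (m - 1 + k) - 1))).encard := by
  have hshift := encard_evenOddMultisets_shift (2 * k) 0 2 (2 * (m - 1 - 1 + k) - 1) (m - 1 - 1)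
    (n - (4 * k + 4))
  rw [show n - (4 * (k : ℤ) + 4) - 2 * (2 : ℕ) * (m - 1 - 1) =
      n - (2 * (m + k) - 1) - (2 * (m - 1 + k) - 1) by push_cast; ring] at hshift
  have hinj : Function.Injective fun t : Multiset ℕ => (2 * k + 2) ::ₘ (2 * k + 2) ::ₘ t :=
    fun _ _ h => (Multiset.cons_inj_right _).1 ((Multiset.cons_inj_right _).1 h)
  rw [← hshift, ← hinj.encard_image (evenOddMultisets _ _ _ _ _)]
  congr 1
  ext s
  simp only [evenOddMultisets, Set.mem_ofPred_eq, Set.mem_image]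
  constructor
  · rintro ⟨⟨h1, h2, h3, h4, h5, h6⟩, h7⟩
    obtain ⟨t, rfl⟩ : ∃ t, (2 * k + 2) ::ₘ (2 * k + 2) ::ₘ t = s := by
      have hle : Multiset.replicate 2 (2 * k + 2) ≤ s := 
        Multiset.le_count_iff_replicate_le.1 (by omega)
      obtain ⟨t, rfl⟩ := Multiset.le_iff_exists_add.1 hle
      exact ⟨t, by simp [Multiset.replicate_succ]⟩
    rw [Multiset.sum_cons, Multiset.sum_cons] at h1
    rw [Multiset.card_cons, Multiset.card_cons] at h2
    have h4 : 2 * k ∉ (2 * k + 2) ::ₘ (2 * k + 2) ::ₘ t := by simpa using h4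
    have hgap := h6 (2 * k + 2) (by grind)
    simp only [Multiset.count_cons_self] at hgap
    have hnot2 : 2 * k + 2 ∉ t := Multiset.count_eq_zero.1 (by omega)
    have hcount4 : t.count (2 * k + 2 + 2) = 0 := by
      rw [Multiset.count_cons_of_ne (by omega), Multiset.count_cons_of_ne (by omega)] at hgap
      omega
    refine ⟨t, ⟨by omega, by omega, fun x hx => ?_, hcount4.le, fun x hx he => ?_,
      fun x hx => ?_⟩, rfl⟩
    · have hpos := Multiset.card_pos_iff_exists_mem.2 ⟨x, hx⟩
      have : x ≠ 2 * k + 2 := fun h => hnot2 (h ▸ hx)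
      have hx := Multiset.mem_cons_of_mem (b := 2 * k + 2)
        (Multiset.mem_cons_of_mem (b := 2 * k + 2) hx)
      have := h3 x hx
      have : x ≠ 2 * k := fun h => h4 (h ▸ hx)
      by_cases he : Even x
      · rw [Nat.even_iff] at he
        omega
      · have := h5 x hx he
        rw [Nat.even_iff] at he
        omega
    · have := h5 x (Multiset.mem_cons_of_mem (Multiset.mem_cons_of_mem hx)) he
      omega
    · have := h6 x hx
      simp only [Multiset.count_cons] at this
      omega
  · rintro ⟨t, ⟨h1, h2, h3, h4, h5, h6⟩, rfl⟩
    have h4 : t.count (2 * k + 2 + 2) = 0 := by simpa using h4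
    have hlt : ∀ x, x < 2 * k + 4 → t.count x = 0 := fun x hx =>
      Multiset.count_eq_zero.2 fun hm => absurd (h3 x hm) (by omega)
    refine ⟨⟨?_, ?_, ?_, ?_, ?_, fun x hx => ?_⟩, ?_⟩
    · rw [Multiset.sum_cons, Multiset.sum_cons]
      omega
    · rw [Multiset.card_cons, Multiset.card_cons]
      omega
    · intro x hx
      simp only [Multiset.mem_cons] at hx
      rcases hx with rfl | rfl | hx
      · omega
      · omega
      · have := h3 x hx
        omega
    · rw [Multiset.count_cons_of_ne (by omega), Multiset.count_cons_of_ne (by omega),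
        hlt _ (by omega)]
    · intro x hx he
      simp only [Multiset.mem_cons] at hx
      rcases hx with rfl | rfl | hx
      · exact absurd (by grind) he
      · exact absurd (by grind) he
      · have := h5 x hx he
        omega
    · have := h6 x hx
      simp only [Multiset.count_cons]
      by_cases hx1 : x = 2 * k + 2
      · subst hx1
        rw [h4, hlt _ (by omega)]
        split_ifs <;> omega
      · by_cases hx2 : x + 2 = 2 * k + 2
        · rw [hx2, hlt x (by omega), hlt _ (by omega)]
          split_ifs <;> omega
        · rw [if_neg hx1, if_neg hx2]
          omega
    · simp

theorem encard_evenOddMultisets_split {k : ℕ} {m : ℤ} (hm : 1 ≤ m) (n : ℤ) :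
    (evenOddMultisets (2 * k) 0 (2 * (m + k) - 1) m n).encard =
      (evenOddMultisets (2 * k) 0 (2 * (m - 1 - 1 + k) - 1) (m - 1 - 1)
        (n - (2 * (m + k) - 1) - (2 * (m - 1 + k) - 1))).encard +
      (evenOddMultisets (2 * k) 1 (2 * (m - 1 + k) - 1) (m - 1)
        (n - (2 * (m + k) - 1) - 2 * (m - 1))).encard +
      (evenOddMultisets (2 * k) 1 (2 * (m + k) - 1) m (n - 2 * m)).encard := by
  rw [← encard_evenOddMultisets_two_le_count, ← encard_evenOddMultisets_mem hm,
    ← encard_evenOddMultisets_not_mem hm, ← Set.encard_union_eq, ← Set.encard_union_eq]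
  · congr 1
    ext s
    simp only [Set.mem_union, Set.mem_ofPred_eq]
    tauto
  · rw [Set.disjoint_left]
    simp only [Set.mem_union, Set.mem_ofPred_eq]
    tauto
  · rw [Set.disjoint_left]
    simp only [Set.mem_ofPred_eq]
    tauto

theorem encard_evenOddMultisets_recursion (k m : ℕ) (n : ℤ) :
    (evenOddMultisets (2 * k) 0 (2 * ((m : ℤ) + k) - 1) m n).encard =
      (evenOddMultisets (2 * k) 0 (2 * ((m : ℤ) - 1 + k) - 1) (m - 1)
        (n - (2 * (m + k) - 1))).encard +
      (evenOddMultisets (2 * k) 1 (2 * ((m : ℤ) + k) - 1) m (n - 2 * m)).encard := by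
  induction m generalizing n with
  | zero =>
    have hempty : evenOddMultisets (2 * k) 0 (2 * (((0 : ℕ) : ℤ) - 1 + k) - 1) ((0 : ℕ) - 1)
        (n - (2 * ((0 : ℕ) + k) - 1)) = ∅ := by
      ext s
      simp only [evenOddMultisets, Set.mem_ofPred_eq, Set.mem_empty_iff_false, iff_false]
      omega
    rw [hempty, Set.encard_empty, zero_add]
    congr 1
    ext s
    simp only [evenOddMultisets, Set.mem_ofPred_eq, Nat.cast_inj, Multiset.card_eq_zero]
    constructor <;> rintro ⟨h1, rfl, -⟩ <;> simpa using h1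
  | succ m ih =>
    rw [encard_evenOddMultisets_split (by omega)]
    have hcast : ((m + 1 : ℕ) : ℤ) - 1 = m := by push_cast; ring
    rw [hcast, ← ih]

/-- For `k ≥ 1`, `m ≥ 1` and `n ≥ 2m + 2k - 1`,
`p^{2k}_{2,1}(m,n) = p^{2k}_{2,1}(m-1, n - 2m - 2k + 1) + p^{2k}_{2,2}(m, n - 2m)`. -/
theorem p2k_recursion_sum (k m n : ℕ) (hk : 1 ≤ k) (hm : 1 ≤ m)
    (hn : 2 * m + 2 * k - 1 ≤ n) :
    p2k k 1 m n =
      p2k k 1 (m - 1) (n + 1 - 2 * m - 2 * k) + p2k k 2 m (n - 2 * m) := by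
  obtain ⟨m, rfl⟩ := Nat.exists_eq_add_of_le' hm
  have h := encard_evenOddMultisets_recursion k (m + 1) n
  have h1 := coe_p2k_eq_encard hk 1 (m + 1) n
  have h2 := coe_p2k_eq_encard hk 1 m (n + 1 - 2 * (m + 1) - 2 * k)
  have h3 := coe_p2k_eq_encard hk 2 (m + 1) (n - 2 * (m + 1))
  rw [show ((n + 1 - 2 * (m + 1) - 2 * k : ℕ) : ℤ) = n - (2 * ((m + 1 : ℕ) + k) - 1) by omega]
    at h2
  rw [show ((n - 2 * (m + 1) : ℕ) : ℤ) = n - 2 * (m + 1 : ℕ) by omega] at h3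
  rw [show ((m + 1 : ℕ) : ℤ) - 1 = m by omega, ← h1, ← h2, ← h3] at h
  exact_mod_cast h
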